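/- Let 𝓜 ⊆ 𝒲 be a set of solitary waves such that the image τ(𝓜) is a connected subset of the space of bounded continuous functions from [0, ∞) to ℝ⁷ with the supremum metric. Suppose 𝓜 contains at least one trivial wave and that every wave in 𝓜 satisfies g − γ(0)·u∞(0) > 0 (equivalently, g + (u∞)_y(0)·u∞(0) > 0). Then for every wave in 𝓜 and every point of the closure of Ω one has |v| < |u|; in other words, the slope |v/u| of every streamline of every wave in 𝓜 is strictly less than 1. -/

import Mathlib

open Set

/-- Partial derivative in the horizontal direction. -/
noncomputable def pdX (f : ℝ × ℝ → ℝ) (p : ℝ × ℝ) : ℝ := fderiv ℝ f p (1, 0)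

/-- Partial derivative in the vertical direction. -/
noncomputable def pdY (f : ℝ × ℝ → ℝ) (p : ℝ × ℝ) : ℝ := fderiv ℝ f p (0, 1)

/-- A symmetric steady solitary gravity water wave with vorticity, in the frame moving
with the wave.  The fluid occupies `Ω = {(x,y) : x ∈ ℝ, -d < y < η x}`; `u, v` are the
relative velocity components, `P` is the pressure, `η` the surface profile, `uInf` the
asymptotic horizontal velocity, `ψ` the stream function and `γ` the vorticity
function. -/
structure SolitaryWave (g Patm : ℝ) : Type where
  u : ℝ × ℝ → ℝ
  v : ℝ × ℝ → ℝ
  P : ℝ × ℝ → ℝ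
  η : ℝ → ℝ
  uInf : ℝ → ℝ
  ψ : ℝ × ℝ → ℝ
  γ : ℝ → ℝ
  d : ℝ
  m : ℝ
  d_pos : 0 < d
  m_pos : 0 < m
  u_smooth : ContDiff ℝ 3 u
  v_smooth : ContDiff ℝ 3 v
  P_smooth : ContDiff ℝ 3 P
  η_smooth : ContDiff ℝ 4 η
  uInf_smooth : ContDiff ℝ 3 uInf
  ψ_smooth : ContDiff ℝ 4 ψ
  γ_smooth : ContDiffOn ℝ 2 γ (Icc 0 m)
  u_bdd : ∀ k : ℕ, k ≤ 3 → ∃ C, ∀ p, ‖iteratedFDeriv ℝ k u p‖ ≤ C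
  v_bdd : ∀ k : ℕ, k ≤ 3 → ∃ C, ∀ p, ‖iteratedFDeriv ℝ k v p‖ ≤ C
  P_bdd : ∀ k : ℕ, k ≤ 3 → ∃ C, ∀ p, ‖iteratedFDeriv ℝ k P p‖ ≤ C
  η_bdd : ∀ k : ℕ, k ≤ 4 → ∃ C, ∀ x, |iteratedDeriv k η x| ≤ C
  u_even : ∀ x y, u (-x, y) = u (x, y)
  v_odd : ∀ x y, v (-x, y) = -v (x, y)
  P_even : ∀ x y, P (-x, y) = P (x, y)
  η_even : ∀ x, η (-x) = η x
  euler_x : ∀ x y, -d < y → y < η x →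
    u (x, y) * pdX u (x, y) + v (x, y) * pdY u (x, y) = -pdX P (x, y)
  euler_y : ∀ x y, -d < y → y < η x →
    u (x, y) * pdX v (x, y) + v (x, y) * pdY v (x, y) = -(pdY P (x, y)) - g
  incompressible : ∀ x y, -d < y → y < η x → pdX u (x, y) + pdY v (x, y) = 0
  surface_pressure : ∀ x, P (x, η x) = Patm
  surface_kinematic : ∀ x, v (x, η x) = deriv η x * u (x, η x)
  bed_kinematic : ∀ x, v (x, -d) = 0
  nonstagnant : ∃ δ > 0, ∀ x y, -d ≤ y → y ≤ η x → u (x, y) ≤ -δ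
  psi_x : ∀ x y, -d ≤ y → y ≤ η x → pdX ψ (x, y) = -v (x, y)
  psi_y : ∀ x y, -d ≤ y → y ≤ η x → pdY ψ (x, y) = u (x, y)
  psi_surface : ∀ x, ψ (x, η x) = 0
  psi_bed : ∀ x, ψ (x, -d) = m
  vorticity_eq : ∀ x y, -d < y → y < η x → pdX v (x, y) - pdY u (x, y) = γ (ψ (x, y))
  /-- Asymptotic conditions: uniformly in `y` as `x → ±∞`, `η → 0`, `Dᵏ v → 0` and
  `Dᵏ u → Dᵏ uInf` for all partial derivatives of order `k = 0, 1, 2`. -/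
  asymptotic : ∀ ε > 0, ∃ R, ∀ x y, R ≤ |x| → -d ≤ y → y ≤ η x →
    |η x| < ε ∧
    |v (x, y)| < ε ∧ |pdX v (x, y)| < ε ∧ |pdY v (x, y)| < ε ∧
    |pdX (pdX v) (x, y)| < ε ∧ |pdY (pdX v) (x, y)| < ε ∧ |pdY (pdY v) (x, y)| < ε ∧
    |u (x, y) - uInf y| < ε ∧ |pdX u (x, y)| < ε ∧ |pdY u (x, y) - deriv uInf y| < ε ∧
    |pdX (pdX u) (x, y)| < ε ∧ |pdY (pdX u) (x, y)| < ε ∧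
    |pdY (pdY u) (x, y) - deriv (deriv uInf) y| < ε

namespace SolitaryWave

variable {g Patm : ℝ}

/-- The closure of the fluid domain `Ω`. -/
def Ωbar (W : SolitaryWave g Patm) : Set (ℝ × ℝ) :=
  {p | -W.d ≤ p.2 ∧ p.2 ≤ W.η p.1}

/-- The open right half `Ω⁺` of the fluid domain. -/
def Ωplus (W : SolitaryWave g Patm) : Set (ℝ × ℝ) :=
  {p | 0 < p.1 ∧ -W.d < p.2 ∧ p.2 < W.η p.1}

/-- The right half `S⁺` of the free surface. -/
def Splus (W : SolitaryWave g Patm) : Set (ℝ × ℝ) :=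
  {p | 0 < p.1 ∧ p.2 = W.η p.1}

/-- A solitary wave is trivial if `v ≡ 0`, `η ≡ 0` and `u (x, y) = uInf y`. -/
def IsTrivial (W : SolitaryWave g Patm) : Prop :=
  (∀ p, W.v p = 0) ∧ (∀ x, W.η x = 0) ∧ (∀ x y, W.u (x, y) = W.uInf y)

/-- The streamline monotonicity condition `v > 0` on `Ω⁺ ∪ S⁺`. -/
def MonotoneHalf (W : SolitaryWave g Patm) : Prop :=
  ∀ p ∈ W.Ωplus ∪ W.Splus, 0 < W.v p

/-- Membership in the water-wave set 𝒲 : the vorticity function satisfies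
`γ ≤ 0`, `γ' ≤ 0`, `γ'' ≤ 0` on `[0, m]`, and the wave is either trivial or
monotone. -/
def MemW (W : SolitaryWave g Patm) : Prop :=
  (∀ s ∈ Icc (0:ℝ) W.m, W.γ s ≤ 0) ∧
  (∀ s ∈ Icc (0:ℝ) W.m, derivWithin W.γ (Icc 0 W.m) s ≤ 0) ∧
  (∀ s ∈ Icc (0:ℝ) W.m, derivWithin (derivWithin W.γ (Icc 0 W.m)) (Icc 0 W.m) s ≤ 0) ∧
  (W.IsTrivial ∨ W.MonotoneHalf)

/-- The trace of `(u, v, u_x, v_x, u_y, u_xx, u_xy)` on the free surface. -/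
noncomputable def trace (W : SolitaryWave g Patm) (x : ℝ) :
    ℝ × ℝ × ℝ × ℝ × ℝ × ℝ × ℝ :=
  (W.u (x, W.η x), W.v (x, W.η x), pdX W.u (x, W.η x), pdX W.v (x, W.η x),
    pdY W.u (x, W.η x), pdX (pdX W.u) (x, W.η x), pdY (pdX W.u) (x, W.η x))

end SolitaryWave

section

open Filter Topology

lemma quadratic_pos_of_sq_le {α β κ m X : ℝ} (hα : 0 < α) (hκ : 0 < κ)
    (hm : m ^ 2 ≤ α * κ) (hβ : 0 < β + 2 * m) (hX : 0 ≤ X) :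
    0 < α * X ^ 2 + β * X + κ := by
  have h1 : 2 * m * X ≤ α * X ^ 2 + κ := by
    apply le_of_sq_le_sq _ (by positivity)
    nlinarith [sq_nonneg (α * X ^ 2 - κ), mul_le_mul_of_nonneg_right hm (sq_nonneg X)]
  rcases hX.eq_or_lt with rfl | hX
  · simpa using hκ
  · nlinarith [mul_pos hX hβ]

lemma affine_pos_of_endpoints {A B k κ : ℝ} (h0 : 0 < A) (h1 : 0 < A + B * κ) (hk : 0 ≤ k)
    (hkκ : k ≤ κ) : 0 < A + B * k := by
  rcases le_total 0 B with hB | hB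
  · have := mul_nonneg hB hk
    linarith
  · have := mul_le_mul_of_nonpos_left hkκ hB
    linarith

lemma slope_poly_pos_of_le_one {t k : ℝ} (ht : 0 < t) (ht1 : t ≤ 1) (hk : 0 ≤ k)
    (hk1 : k ^ 2 * (1 + t ^ 2) ≤ 1) :
    0 < (t + 1 / 32) * t ^ 2 * (-((1 + t ^ 2) * (2 + k)) + 4 * (1 - k))
      + 1 / 32 * (1 - 6 * t ^ 2 + t ^ 4 - (1 - t ^ 4) * k)
      + 2 * ((1 + t ^ 2) * t * (t ^ 2 + 1 / 32) * (1 + 41 / 100 * k)) := by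
  set κ : ℝ := 1 - t ^ 2 / 2 + 3 / 8 * t ^ 4 with hκ
  have hκ0 : 0 < κ := by nlinarith [sq_nonneg (t ^ 2 - 2 / 3)]
  have hkκ : k ≤ κ := by
    have : 1 ≤ κ ^ 2 * (1 + t ^ 2) := by
      have : κ ^ 2 * (1 + t ^ 2) - 1 = t ^ 6 * (40 - 15 * t ^ 2 + 9 * t ^ 4) / 64 := by
        rw [hκ]; ring
      have h2 : 0 ≤ t ^ 6 * (40 - 15 * t ^ 2 + 9 * t ^ 4) := by
        apply mul_nonneg (by positivity)
        nlinarith [sq_nonneg (t ^ 2 - 1)]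
      linarith
    have h3 : k ^ 2 ≤ κ ^ 2 := by
      apply le_of_mul_le_mul_right (hk1.trans this) (by positivity)
    exact le_of_sq_le_sq h3 hκ0.le
  have e0 : 0 < (t + 1 / 32) * t ^ 2 * (-((1 + t ^ 2) * (2 + 0)) + 4 * (1 - 0))
      + 1 / 32 * (1 - 6 * t ^ 2 + t ^ 4 - (1 - t ^ 4) * 0)
      + 2 * ((1 + t ^ 2) * t * (t ^ 2 + 1 / 32) * (1 + 41 / 100 * 0)) := by
    have hs : 0 ≤ 1 - t := by linarith
    have : 0 < 1 / 32 * (1 - t) ^ 4 + 3 / 16 * t * (1 - t) ^ 3 + 1 / 4 * t ^ 2 * (1 - t) ^ 2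
      + 33 / 8 * t ^ 3 * (1 - t) + 4 * t ^ 4 := by positivity
    nlinarith [this]
  have e1 : 0 < (t + 1 / 32) * t ^ 2 * (-((1 + t ^ 2) * (2 + κ)) + 4 * (1 - κ))
      + 1 / 32 * (1 - 6 * t ^ 2 + t ^ 4 - (1 - t ^ 4) * κ)
      + 2 * ((1 + t ^ 2) * t * (t ^ 2 + 1 / 32) * (1 + 41 / 100 * κ)) := by
    have key : 0 < 141 / 1600 - 17 / 64 * t - 67 / 640 * t ^ 2 + 9 / 256 * t ^ 3
        + 24407 / 12800 * t ^ 4 - 15 / 256 * t ^ 5 - 18789 / 12800 * t ^ 6 - 27 / 400 * t ^ 8 := by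
      rcases le_total t (1 / 2) with h | h
      · have hs : 0 ≤ 1 - 2 * t := by linarith
        have : 0 < 141/1600 * (1 - 2 * t) ^ 8 + 1831/3200 * (2 * t) * (1 - 2 * t) ^ 7
          + 19349/12800 * (2 * t) ^ 2 * (1 - 2 * t) ^ 6
          + 102057/51200 * (2 * t) ^ 3 * (1 - 2 * t) ^ 5
          + 259867/204800 * (2 * t) ^ 4 * (1 - 2 * t) ^ 4
          + 57741/204800 * (2 * t) ^ 5 * (1 - 2 * t) ^ 3
          + 2691/163840 * (2 * t) ^ 6 * (1 - 2 * t) ^ 2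
          + 5373/81920 * (2 * t) ^ 7 * (1 - 2 * t) + 907/32768 * (2 * t) ^ 8 := by positivity
        linarith
      · have hs : 0 ≤ 2 * t - 1 := by linarith
        have hr : 0 ≤ 2 - 2 * t := by linarith
        have h8 : 0 < 907/32768 * (2 - 2 * t) ^ 8 + 421/6400 * (2 * t - 1) ^ 8 := by
          rcases h.eq_or_lt with rfl | h
          · norm_num
          · have : 0 < 2 * t - 1 := by linarith
            positivity
        have : 0 ≤ 30907/81920 * (2 * t - 1) * (2 - 2 * t) ^ 7
          + 360167/163840 * (2 * t - 1) ^ 2 * (2 - 2 * t) ^ 6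
          + 696947/102400 * (2 * t - 1) ^ 3 * (2 - 2 * t) ^ 5
          + 1236091/102400 * (2 * t - 1) ^ 4 * (2 - 2 * t) ^ 4
          + 633867/51200 * (2 * t - 1) ^ 5 * (2 - 2 * t) ^ 3
          + 354201/51200 * (2 * t - 1) ^ 6 * (2 - 2 * t) ^ 2
          + 4397/2560 * (2 * t - 1) ^ 7 * (2 - 2 * t) := by positivity
        linarith
    have := mul_pos ht key
    rw [hκ]
    linarith
  have := affine_pos_of_endpoints
    (A := (t + 1 / 32) * t ^ 2 * (-((1 + t ^ 2) * 2) + 4) + 1 / 32 * (1 - 6 * t ^ 2 + t ^ 4)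
      + 2 * ((1 + t ^ 2) * t * (t ^ 2 + 1 / 32)))
    (B := (t + 1 / 32) * t ^ 2 * (-(1 + t ^ 2) - 4) - 1 / 32 * (1 - t ^ 4)
      + 2 * ((1 + t ^ 2) * t * (t ^ 2 + 1 / 32)) * (41 / 100))
    (by linarith) (by linarith) hk hkκ
  linarith

lemma slope_poly_pos_of_one_le {t k : ℝ} (ht : 1 ≤ t) (hk : 0 ≤ k)
    (hk1 : k ^ 2 * (1 + t ^ 2) ≤ 1) :
    0 < (t + 1 / 32) * t ^ 2 * (-((1 + t ^ 2) * (2 + k)) + 4 * (1 - k))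
      + 1 / 32 * (1 - 6 * t ^ 2 + t ^ 4 - (1 - t ^ 4) * k)
      + 2 * ((1 + t ^ 2) * (t ^ 3 + t ^ 2 / 64 - t / 8192) * (1 + k / 2 - k ^ 2 / 8)) := by
  have hk7 : k ≤ 71 / 100 := by
    have : k ^ 2 * 2 ≤ 1 := by nlinarith [sq_nonneg k]
    nlinarith
  obtain ⟨s, hs, rfl⟩ : ∃ s, 0 ≤ s ∧ t = 1 + s := ⟨t - 1, by linarith, by ring⟩
  have h2 : (k ^ 2 * (1 + (1 + s) ^ 2)) * ((1 + s) ^ 3 + (1 + s) ^ 2 / 64 - (1 + s) / 8192) ≤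
      1 * ((1 + s) ^ 3 + (1 + s) ^ 2 / 64 - (1 + s) / 8192) := by
    apply mul_le_mul_of_nonneg_right hk1
    have : (1 + s) ^ 3 + (1 + s) ^ 2 / 64 - (1 + s) / 8192 =
      (1 + 1/64 - 1/8192) + (3 + 1/32 - 1/8192) * s + (3 + 1/64) * s ^ 2 + s ^ 3 := by ring
    rw [this]; positivity
  have h3 : 0 < (71 / 100 - k) * (7543/2048 + 11319/1024 * s + 45677/4096 * s^2 + 15359/4096 * s^3) +
      k * (11993/16384 + 19481/8192 * s + 2128339/819200 * s^2 + 781553/819200 * s^3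
        + 71/6400 * s^4) := by
    rcases hk.eq_or_lt with rfl | hk
    · positivity
    · have := sub_nonneg.2 hk7
      positivity
  nlinarith [h2, h3]

lemma touching_form_pos {t k X : ℝ} (ht : 0 < t) (hk : 0 ≤ k)
    (hk1 : k ^ 2 * (1 + t ^ 2) ≤ 1) (hX : 0 ≤ X) :
    0 < (t + 1 / 32) * (t ^ 2 * (1 + t ^ 2) * (X - 1) * (X - 1 - k) + 4 * t ^ 2 * X * (1 - k))
      + X * (1 / 32) * (1 - 6 * t ^ 2 + t ^ 4 + (1 - t ^ 4) * (X - k)) := by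
  have hk2 : k ≤ 1 := by nlinarith [mul_nonneg (sq_nonneg k) (sq_nonneg t)]
  have hα : 0 < (1 + t ^ 2) * (t ^ 3 + 1 / 32) := by positivity
  have hκ : 0 < (t + 1 / 32) * t ^ 2 * (1 + t ^ 2) * (1 + k) := by positivity
  obtain ⟨m, hm, hβ⟩ : ∃ m,
      m ^ 2 ≤ (1 + t ^ 2) * (t ^ 3 + 1 / 32) * ((t + 1 / 32) * t ^ 2 * (1 + t ^ 2) * (1 + k)) ∧
      0 < ((t + 1 / 32) * t ^ 2 * (-((1 + t ^ 2) * (2 + k)) + 4 * (1 - k))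
      + 1 / 32 * (1 - 6 * t ^ 2 + t ^ 4 - (1 - t ^ 4) * k)) + 2 * m := by
    rcases le_total t 1 with h | h
    · refine ⟨_, ?_, slope_poly_pos_of_le_one ht h hk hk1⟩
      have h1 : (1 + 41 / 100 * k) ^ 2 ≤ 1 + k := by nlinarith
      have h2 : (t ^ 2 + 1 / 32) ^ 2 ≤ (t ^ 3 + 1 / 32) * (t + 1 / 32) := by
        nlinarith [mul_nonneg ht.le (sq_nonneg (t - 1))]
      calc _ = ((1 + t ^ 2) * t) ^ 2 * ((t ^ 2 + 1 / 32) ^ 2 * (1 + 41 / 100 * k) ^ 2) := by ring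
        _ ≤ ((1 + t ^ 2) * t) ^ 2 * ((t ^ 3 + 1 / 32) * (t + 1 / 32) * (1 + k)) := by gcongr
        _ = _ := by ring
    · refine ⟨_, ?_, slope_poly_pos_of_one_le h hk hk1⟩
      have h1 : (1 + k / 2 - k ^ 2 / 8) ^ 2 ≤ 1 + k := by
        have : (1 + k / 2 - k ^ 2 / 8) ^ 2 = 1 + k - k ^ 3 * (8 - k) / 64 := by ring
        have : 0 ≤ k ^ 3 * (8 - k) := mul_nonneg (by positivity) (by linarith)
        linarith
      have h2 : (t ^ 3 + t ^ 2 / 64 - t / 8192) ^ 2 ≤ (t ^ 3 + 1 / 32) * (t + 1 / 32) * t ^ 2 := by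
        have : (t ^ 3 + 1 / 32) * (t + 1 / 32) * t ^ 2 - (t ^ 3 + t ^ 2 / 64 - t / 8192) ^ 2 =
          t ^ 3 * (1 / 32 + 1 / 262144) + t ^ 2 * (1 / 1024 - 1 / 67108864) := by ring
        have : 0 < t ^ 3 * (1 / 32 + 1 / 262144) + t ^ 2 * (1 / 1024 - 1 / 67108864) := by
          norm_num; positivity
        linarith
      calc _ = (1 + t ^ 2) ^ 2 *
            ((t ^ 3 + t ^ 2 / 64 - t / 8192) ^ 2 * (1 + k / 2 - k ^ 2 / 8) ^ 2) := by ring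
        _ ≤ (1 + t ^ 2) ^ 2 * ((t ^ 3 + 1 / 32) * (t + 1 / 32) * t ^ 2 * (1 + k)) := by gcongr
        _ = _ := by ring
  have := quadratic_pos_of_sq_le hα hκ hm hβ hX
  linarith

/-- Algebraic contradiction at a surface point where `u_x - R (v - u / 32)` attains its maximum
zero, in variables normalised by the horizontal speed `s`. -/
lemma touching_false_normalized {s t G k Z A C c p a b : ℝ} (hs : 0 < s) (ht : 0 < t)
    (hG : 0 < G) (hk : 0 ≤ k) (hk1 : k ^ 2 * (1 + t ^ 2) ≤ 1) (hZ : 0 ≤ Z) (hc : 0 ≤ c)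
    (hp : p = t * Z * (t + 1 / 32) * G) (hγ : a - b = k * G)
    (hsum : a + b = G * (1 + Z * (t + 1 / 32) * (1 - t ^ 2)))
    (hT : s * (-A + t * C) = t * Z * G * (-b - t * p - 1 / 32 * (-p + t * a)))
    (hN : t * Z * G * (t * b - p - 1 / 32 * (t * p + a)) ≤ s * (t * A + C))
    (hB : (-p + t * a) ^ 2 + (-b - t * p) ^ 2
      - ((-p + t * a) * p + (-b - t * p) * a
        + s * (A - 2 * t * C - t ^ 2 * (c * s + A)))
      + t * ((-p + t * a) * b - (-b - t * p) * p + s * (c * t * s + C + 2 * t * A - t ^ 2 * C))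
      + G * (-b - t * p) = 0) : False := by
  have hX : 0 ≤ Z * (t + 1 / 32) * (1 + t ^ 2) := by positivity
  have hW := touching_form_pos ht hk hk1 hX
  set X := Z * (t + 1 / 32) * (1 + t ^ 2) with hXd
  set n := s * (t * A + C) - t * Z * G * (t * b - p - 1 / 32 * (t * p + a)) with hn
  have hn0 : 0 ≤ n := sub_nonneg.2 hN
  have ha : a = G * (1 + Z * (t + 1 / 32) * (1 - t ^ 2) + k) / 2 := by linarith
  have hb : b = G * (1 + Z * (t + 1 / 32) * (1 - t ^ 2) - k) / 2 := by linarith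
  have key : G ^ 2 * (t ^ 2 / 2 * (X - 1) * (X - 1 - k) + 2 * t ^ 2 * (Z * (t + 1 / 32)) * (1 - k)
      + Z * (1 / 32) / 2 * (1 - 6 * t ^ 2 + t ^ 4 + (1 - t ^ 4) * (X - k)))
      + 2 * t * n + 2 * c * t ^ 2 * s ^ 2 = 0 := by
    rw [← hB, hn, hXd, hp, ha, hb]
    rw [hp, ha, hb] at hT
    linear_combination (-(1 - t ^ 2)) * hT
  have h1 : 0 < t ^ 2 / 2 * (X - 1) * (X - 1 - k) + 2 * t ^ 2 * (Z * (t + 1 / 32)) * (1 - k)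
      + Z * (1 / 32) / 2 * (1 - 6 * t ^ 2 + t ^ 4 + (1 - t ^ 4) * (X - k)) := by
    refine pos_of_mul_pos_left (b := 2 * (1 + t ^ 2) * (t + 1 / 32)) ?_ (by positivity)
    rw [hXd] at hW ⊢
    linarith
  have : 0 < G ^ 2 * (t ^ 2 / 2 * (X - 1) * (X - 1 - k) + 2 * t ^ 2 * (Z * (t + 1 / 32)) * (1 - k)
      + Z * (1 / 32) / 2 * (1 - 6 * t ^ 2 + t ^ 4 + (1 - t ^ 4) * (X - k))) := by positivity
  have : 0 ≤ 2 * t * n + 2 * c * t ^ 2 * s ^ 2 := by positivity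
  linarith

/-- `p, a, b, A, C` stand for `u_x, u_y, v_x, u_xx, u_xy` at a point of the free surface where
`u_x - R (v - u / 32)` attains its maximum zero; `hB1` and `hB2` are the first two tangential
derivatives of Bernoulli's law. -/
lemma touching_false {u v p a b A C c g R γ : ℝ} (hu : u < 0) (hv : 0 < v) (hg : 0 < g)
    (hc : 0 ≤ c) (hR : 0 ≤ R) (hp : p = R * (v - 1 / 32 * u)) (hγ : b - a = γ) (hγ0 : γ ≤ 0)
    (hγg : γ ^ 2 * (u ^ 2 + v ^ 2) ≤ g ^ 2)
    (hB1 : u * (u * p + v * a) + v * (u * b - v * p) + g * v = 0)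
    (hT : u * A + v * C = R * (u * b - v * p - 1 / 32 * (u * p + v * a)))
    (hN : R * (v * b + u * p - 1 / 32 * (v * p - u * a)) ≤ v * A - u * C)
    (hB2 : (u * p + v * a) ^ 2 + (u * b - v * p) ^ 2
      + u * ((u * p + v * a) * p + (u * b - v * p) * a
        + (u ^ 2 * A + 2 * u * v * C + v ^ 2 * (c * u - A)))
      + v * ((u * p + v * a) * b - (u * b - v * p) * p
        + (u ^ 2 * (c * v + C) - 2 * u * v * A - v ^ 2 * C))
      + g * (u * b - v * p) = 0) : False := by
  obtain ⟨s, rfl⟩ : ∃ s, u = -s := ⟨-u, by ring⟩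
  have hs : 0 < s := by linarith
  obtain ⟨t, rfl⟩ : ∃ t, v = t * s := ⟨v / s, by field_simp⟩
  have ht : 0 < t := pos_of_mul_pos_left hv hs.le
  obtain ⟨G, rfl⟩ : ∃ G, g = G * s := ⟨g / s, by field_simp⟩
  have hG : 0 < G := pos_of_mul_pos_left hg hs.le
  obtain ⟨Z, rfl⟩ : ∃ Z, R = t * Z * G / s := ⟨R * s / (t * G), by field_simp⟩
  have hZ : 0 ≤ Z := by
    have h : 0 ≤ (t * Z * G / s) * (s / (t * G)) := by positivity
    have : (t * Z * G / s) * (s / (t * G)) = Z := by field_simp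
    rwa [this] at h
  obtain ⟨k, hk⟩ : ∃ k, a - b = k * G := ⟨(a - b) / G, by field_simp⟩
  have hk0 : 0 ≤ k := by
    have : 0 ≤ k * G := by linarith
    exact nonneg_of_mul_nonneg_left this hG
  have hk1 : k ^ 2 * (1 + t ^ 2) ≤ 1 := by
    have hγk : γ = -(k * G) := by linarith
    rw [hγk] at hγg
    refine le_of_mul_le_mul_right (a := (G * s) ^ 2) ?_ (by positivity)
    linarith
  have hp' : p = t * Z * (t + 1 / 32) * G := by
    rw [hp]; field_simp; ring
  refine touching_false_normalized (p := p) (a := a) (b := b) (A := A) (C := C) hs ht hG hk0 hk1 hZ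
    hc hp' hk ?_ ?_ ?_ ?_
  · refine mul_left_cancel₀ (mul_pos ht (sq_pos_of_pos hs)).ne' ?_
    linear_combination (-1 : ℝ) * hB1 + s ^ 2 * (1 - t ^ 2) * hp'
  · field_simp at hT
    refine mul_left_cancel₀ hs.ne' ?_
    linear_combination s / 32 * hT
  · refine le_of_mul_le_mul_left (a := s) ?_ hs
    have e : t * Z * G / s * (t * s * b + -s * p - 1 / 32 * (t * s * p - -s * a)) =
      t * Z * G * (t * b - p - 1 / 32 * (t * p + a)) := by field_simp; ring
    rw [e] at hN
    nlinarith
  · refine mul_left_cancel₀ (pow_pos hs 2).ne' ?_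
    linear_combination hB2

lemma slope_max_false {u v p a b g : ℝ} (hu : u < 0) (hg : 0 < g) (hp : p < 0)
    (hγ0 : b - a ≤ 0) (huv : -u ≤ v)
    (hB1 : u * (u * p + v * a) + v * (u * b - v * p) + g * v = 0)
    (hT : u * (u * b - v * p) = v * (u * p + v * a)) : False := by
  obtain ⟨s, rfl⟩ : ∃ s, u = -s := ⟨-u, by ring⟩
  have hs : 0 < s := by linarith
  obtain ⟨t, rfl⟩ : ∃ t, v = t * s := ⟨v / s, by field_simp⟩
  have ht : 1 ≤ t := by nlinarith
  have h1 : s * (p * (1 - t ^ 2) - t * (a + b)) + g * t = 0 :=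
    mul_left_cancel₀ hs.ne' (by linear_combination hB1)
  have h2 : b + 2 * t * p - t ^ 2 * a = 0 :=
    mul_left_cancel₀ (pow_pos hs 2).ne' (by linear_combination hT)
  have h3 : s * (p * (1 + t ^ 2) ^ 2) =
      t * (s * (a - b) * (1 + t ^ 2) + g * (t ^ 2 - 1)) := by
    linear_combination (1 - t ^ 2) * h1 + 2 * t * s * h2
  have h4 : 0 ≤ t * (s * (a - b) * (1 + t ^ 2) + g * (t ^ 2 - 1)) := by
    have : 0 ≤ a - b := by linarith
    have : 0 ≤ t ^ 2 - 1 := by nlinarith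
    positivity
  have h5 : p * (1 + t ^ 2) ^ 2 < 0 := mul_neg_of_neg_of_pos hp (by positivity)
  nlinarith

section PartialDerivatives

variable {f : ℝ × ℝ → ℝ}

lemma ContDiff.pdX {n : ℕ} (hf : ContDiff ℝ (n + 1 : ℕ) f) : ContDiff ℝ n (pdX f) :=
  (hf.fderiv_right (m := n) (by norm_cast)).clm_apply contDiff_const

lemma ContDiff.pdY {n : ℕ} (hf : ContDiff ℝ (n + 1 : ℕ) f) : ContDiff ℝ n (pdY f) :=
  (hf.fderiv_right (m := n) (by norm_cast)).clm_apply contDiff_const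

lemma hasDerivAt_comp_curve (hf : Differentiable ℝ f) {c₁ c₂ : ℝ → ℝ} {a b s : ℝ}
    (h₁ : HasDerivAt c₁ a s) (h₂ : HasDerivAt c₂ b s) :
    HasDerivAt (fun t => f (c₁ t, c₂ t)) (a * pdX f (c₁ s, c₂ s) + b * pdY f (c₁ s, c₂ s)) s := by
  have h := (hf (c₁ s, c₂ s)).hasFDerivAt.comp_hasDerivAt s (h₁.prodMk h₂)
  have e : ((a, b) : ℝ × ℝ) = a • (1, 0) + b • (0, 1) := by ext <;> simp
  rw [e, map_add, map_smul, map_smul] at h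
  exact h

lemma hasDerivAt_pdX (hf : Differentiable ℝ f) (x y : ℝ) :
    HasDerivAt (fun t => f (t, y)) (pdX f (x, y)) x := by
  simpa using hasDerivAt_comp_curve hf (hasDerivAt_id x) (hasDerivAt_const x y)

lemma hasDerivAt_pdY (hf : Differentiable ℝ f) (x y : ℝ) :
    HasDerivAt (fun t => f (x, t)) (pdY f (x, y)) y := by
  simpa using hasDerivAt_comp_curve hf (hasDerivAt_const y x) (hasDerivAt_id y)

lemma pdX_pdY_comm (hf : ContDiff ℝ 2 f) (p : ℝ × ℝ) : pdX (pdY f) p = pdY (pdX f) p := by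
  have hs : IsSymmSndFDerivAt ℝ f p := hf.contDiffAt.isSymmSndFDerivAt (by simp)
  have hd : DifferentiableAt ℝ (fderiv ℝ f) p :=
    ((hf.fderiv_right (m := 1) (by norm_cast)).differentiable (by simp)) p
  have key : ∀ a b : ℝ × ℝ, fderiv ℝ (fun q => fderiv ℝ f q a) p b = fderiv ℝ (fderiv ℝ f) p b a := by
    intro a b
    rw [fderiv_clm_apply hd (differentiableAt_const a)]
    simp
  change fderiv ℝ (fun q => fderiv ℝ f q (0, 1)) p (1, 0) =
    fderiv ℝ (fun q => fderiv ℝ f q (1, 0)) p (0, 1)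
  rw [key, key]
  exact hs (1, 0) (0, 1)

lemma fderiv_lin_comb {f₁ f₂ f₃ : ℝ × ℝ → ℝ} (h₁ : Differentiable ℝ f₁)
    (h₂ : Differentiable ℝ f₂) (h₃ : Differentiable ℝ f₃) (a b c : ℝ) (p : ℝ × ℝ) :
    fderiv ℝ (fun q => a * f₁ q + b * f₂ q + c * f₃ q) p =
      a • fderiv ℝ f₁ p + b • fderiv ℝ f₂ p + c • fderiv ℝ f₃ p :=
  ((((h₁ p).hasFDerivAt.const_mul a).add ((h₂ p).hasFDerivAt.const_mul b)).add
    ((h₃ p).hasFDerivAt.const_mul c)).fderiv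

lemma pdX_lin_comb {f₁ f₂ f₃ : ℝ × ℝ → ℝ} (h₁ : Differentiable ℝ f₁)
    (h₂ : Differentiable ℝ f₂) (h₃ : Differentiable ℝ f₃) (a b c : ℝ) :
    pdX (fun q => a * f₁ q + b * f₂ q + c * f₃ q) =
      fun q => a * pdX f₁ q + b * pdX f₂ q + c * pdX f₃ q := by
  ext p
  simp [pdX, fderiv_lin_comb h₁ h₂ h₃]

lemma pdY_lin_comb {f₁ f₂ f₃ : ℝ × ℝ → ℝ} (h₁ : Differentiable ℝ f₁)
    (h₂ : Differentiable ℝ f₂) (h₃ : Differentiable ℝ f₃) (a b c : ℝ) :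
    pdY (fun q => a * f₁ q + b * f₂ q + c * f₃ q) =
      fun q => a * pdY f₁ q + b * pdY f₂ q + c * pdY f₃ q := by
  ext p
  simp [pdY, fderiv_lin_comb h₁ h₂ h₃]

end PartialDerivatives

lemma IsLocalMax.second_deriv_nonpos {f f' : ℝ → ℝ} {f'' a : ℝ} (hmax : IsLocalMax f a)
    (hf : ∀ x, HasDerivAt f (f' x) x) (hf' : HasDerivAt f' f'' a) : f'' ≤ 0 := by
  by_contra! hpos
  have hd : deriv f = f' := funext fun x => (hf x).deriv
  have hmin : IsLocalMin f a := by
    apply isLocalMin_of_deriv_deriv_pos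
    · rwa [hd, hf'.deriv]
    · exact hmax.deriv_eq_zero
    · exact (hf a).continuousAt
  have hconst : f =ᶠ[𝓝 a] fun _ => f a := by
    filter_upwards [hmax, hmin] with x h1 h2 using le_antisymm h1 h2
  have h0 := hconst.deriv.deriv_eq
  rw [hd, hf'.deriv] at h0
  simp at h0
  exact hpos.ne' h0

/-- A function that is nonpositive to the left of a zero has nonnegative derivative there. -/
lemma HasDerivAt.nonneg_of_nonpos_left {f : ℝ → ℝ} {f' a c : ℝ} (hca : c < a)
    (hf : HasDerivAt f f' a) (ha : f a = 0) (hle : ∀ y, c < y → y < a → f y ≤ 0) : 0 ≤ f' := by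
  have h := hasDerivWithinAt_iff_tendsto_slope' (s := Iio a) (by simp) |>.1 hf.hasDerivWithinAt
  refine ge_of_tendsto h ?_
  filter_upwards [Ioo_mem_nhdsLT hca] with y hy
  rw [slope_def_field, ha, sub_zero]
  exact div_nonneg_of_nonpos (hle y hy.1 hy.2) (by linarith [hy.2])

/-- A function that is nonnegative to the right of a zero has nonnegative derivative there. -/
lemma HasDerivAt.nonneg_of_nonneg_right {f : ℝ → ℝ} {f' a c : ℝ} (hac : a < c)
    (hf : HasDerivAt f f' a) (ha : f a = 0) (hle : ∀ y, a < y → y < c → 0 ≤ f y) : 0 ≤ f' := by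
  have h := hasDerivWithinAt_iff_tendsto_slope' (s := Ioi a) (by simp) |>.1 hf.hasDerivWithinAt
  refine ge_of_tendsto h ?_
  filter_upwards [Ioo_mem_nhdsGT hac] with y hy
  rw [slope_def_field, ha, sub_zero]
  exact div_nonneg (hle y hy.1 hy.2) (by linarith [hy.1])

/-- If `ρ` vanishes at `0` and at infinity and is nonnegative somewhere on `(0, ∞)`, then it
attains a nonnegative maximum over `[0, ∞)` at a positive point. -/
lemma exists_pos_max_of_decay {ρ : ℝ → ℝ} (hρ : Continuous ρ) (h0 : ρ 0 = 0)
    (hinf : ∀ ε > 0, ∃ X, ∀ x ≥ X, ρ x ≤ ε) {x₁ : ℝ} (hx₁ : 0 < x₁) (hρ₁ : 0 ≤ ρ x₁) :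
    ∃ x₀ > 0, ρ x₁ ≤ ρ x₀ ∧ ∀ x ≥ 0, ρ x ≤ ρ x₀ := by
  by_cases hpos : ∃ x ≥ 0, 0 < ρ x
  · obtain ⟨z, hz, hρz⟩ := hpos
    obtain ⟨X, hX⟩ := hinf (ρ z) hρz
    obtain ⟨x₀, hx₀, hmax⟩ := isCompact_Icc.exists_isMaxOn (s := Icc 0 (max X z))
      ⟨0, by simp [hz]⟩ hρ.continuousOn
    have hz' : ρ z ≤ ρ x₀ := hmax ⟨hz, le_max_right _ _⟩
    have hall : ∀ x ≥ 0, ρ x ≤ ρ x₀ := by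
      intro x hx
      rcases le_total x (max X z) with h | h
      · exact hmax ⟨hx, h⟩
      · exact (hX x ((le_max_left _ _).trans h)).trans hz'
    refine ⟨x₀, lt_of_le_of_ne hx₀.1 ?_, hall x₁ hx₁.le, hall⟩
    rintro rfl
    linarith
  · push Not at hpos
    exact ⟨x₁, hx₁, le_rfl, fun x hx => (hpos x hx).trans hρ₁⟩

/-- Weak maximum principle in a half-strip `{x > 0, -d < y < η x}`. -/
lemma nonpos_of_subharmonic_where_pos {h : ℝ × ℝ → ℝ} {η : ℝ → ℝ} {d : ℝ}
    (hh : ContDiff ℝ 2 h) (hη : Continuous η)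
    (haxis : ∀ y, -d ≤ y → y ≤ η 0 → h (0, y) ≤ 0)
    (hbed : ∀ x ≥ 0, h (x, -d) ≤ 0) (htop : ∀ x ≥ 0, h (x, η x) ≤ 0)
    (hinf : ∀ ε > 0, ∃ X, ∀ x ≥ X, ∀ y, -d ≤ y → y ≤ η x → h (x, y) ≤ ε)
    (hsub : ∀ x y, 0 < x → -d < y → y < η x → 0 < h (x, y) →
      0 ≤ pdX (pdX h) (x, y) + pdY (pdY h) (x, y)) :
    ∀ x ≥ 0, ∀ y, -d ≤ y → y ≤ η x → h (x, y) ≤ 0 := by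
  intro x₁ hx₁ y₁ hy₁ hy₁'
  by_contra! hM
  set m := h (x₁, y₁) with hm
  obtain ⟨X₀, hX₀⟩ := hinf (m / 2) (by positivity)
  obtain ⟨X, hXX, hX1⟩ : ∃ X, X₀ ≤ X ∧ x₁ ≤ X := ⟨max X₀ x₁, le_max_left _ _, le_max_right _ _⟩
  set δ := m / (4 * (X ^ 2 + 1)) with hδ
  have hδ0 : 0 < δ := by positivity
  have hδX : ∀ x, 0 ≤ x → x ≤ X → δ * x ^ 2 ≤ m / 4 := by
    intro x hx hxX
    have : x ^ 2 ≤ X ^ 2 + 1 := by nlinarith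
    calc δ * x ^ 2 ≤ δ * (X ^ 2 + 1) := by gcongr
      _ = m / 4 := by rw [hδ]; field_simp
  have hcont : Continuous h := hh.continuous
  set F : ℝ × ℝ → ℝ := fun q => h q + δ * q.1 ^ 2 with hF
  have hFc : Continuous F := by fun_prop
  let K : Set (ℝ × ℝ) := {q | 0 ≤ q.1 ∧ q.1 ≤ X ∧ -d ≤ q.2 ∧ q.2 ≤ η q.1}
  have hK : IsCompact K := by
    obtain ⟨H, hH⟩ := (isCompact_Icc (a := (0 : ℝ)) (b := X)).bddAbove_image hη.continuousOn
    refine (isCompact_Icc (a := (0 : ℝ)) (b := X) |>.prod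
      (isCompact_Icc (a := -d) (b := H))).of_isClosed_subset ?_ ?_
    · refine (isClosed_le continuous_const continuous_fst).inter
        ((isClosed_le continuous_fst continuous_const).inter
        ((isClosed_le continuous_const continuous_snd).inter
        (isClosed_le continuous_snd (hη.comp continuous_fst))))
    · rintro ⟨x, y⟩ ⟨h1, h2, h3, h4⟩
      exact ⟨⟨h1, h2⟩, h3, h4.trans (hH ⟨x, ⟨h1, h2⟩, rfl⟩)⟩
  obtain ⟨⟨a, b⟩, ⟨ha0, haX, hbd, hbη⟩, hmax⟩ :=
    hK.exists_isMaxOn ⟨(x₁, y₁), hx₁, hX1, hy₁, hy₁'⟩ hFc.continuousOn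
  simp only at ha0 haX hbd hbη
  have hFm : m ≤ F (a, b) := by
    have : F (x₁, y₁) ≤ F (a, b) := hmax ⟨hx₁, hX1, hy₁, hy₁'⟩
    have h2 : 0 ≤ δ * x₁ ^ 2 := by positivity
    simp only [hF] at this ⊢
    linarith
  have hhm : 3 / 4 * m ≤ h (a, b) := by
    have := hδX a ha0 haX
    simp only [hF] at hFm
    linarith
  have ha : 0 < a := by
    refine lt_of_le_of_ne ha0 ?_
    rintro rfl
    linarith [haxis b hbd hbη]
  have hb : -d < b := by
    refine lt_of_le_of_ne hbd ?_
    rintro rfl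
    linarith [hbed a ha0]
  have hb' : b < η a := by
    refine lt_of_le_of_ne hbη ?_
    rintro rfl
    linarith [htop a ha0]
  have haX' : a < X := by
    refine lt_of_le_of_ne haX ?_
    rintro rfl
    linarith [hX₀ a hXX b hbd hbη]
  have hloc : IsLocalMax F (a, b) := by
    have hop : IsOpen {q : ℝ × ℝ | 0 < q.1 ∧ q.1 < X ∧ -d < q.2 ∧ q.2 < η q.1} :=
      (isOpen_lt continuous_const continuous_fst).inter
        ((isOpen_lt continuous_fst continuous_const).inter
        ((isOpen_lt continuous_const continuous_snd).inter
        (isOpen_lt continuous_snd (hη.comp continuous_fst))))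
    filter_upwards [hop.mem_nhds ⟨ha, haX', hb, hb'⟩] with q hq
    exact hmax ⟨hq.1.le, hq.2.1.le, hq.2.2.1.le, hq.2.2.2.le⟩
  have hd : Differentiable ℝ h := hh.differentiable (by simp)
  have hdX : Differentiable ℝ (pdX h) := (ContDiff.pdX (n := 1) hh).differentiable (by simp)
  have hdY : Differentiable ℝ (pdY h) := (ContDiff.pdY (n := 1) hh).differentiable (by simp)
  have hxx : pdX (pdX h) (a, b) + 2 * δ ≤ 0 := by
    have hl : IsLocalMax (fun t => F (t, b)) a :=
      hloc.comp_continuous (g := fun t : ℝ => (t, b)) (by fun_prop)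
    refine hl.second_deriv_nonpos (f' := fun t => pdX h (t, b) + δ * (2 * t)) (fun t => ?_) ?_
    · exact ((hasDerivAt_pdX hd t b).fun_add ((hasDerivAt_pow 2 t).const_mul δ)).congr_deriv
        (by simp)
    · exact ((hasDerivAt_pdX hdX a b).fun_add
        (((hasDerivAt_id a).const_mul 2).const_mul δ)).congr_deriv (by ring)
  have hyy : pdY (pdY h) (a, b) ≤ 0 := by
    have hl : IsLocalMax (fun t => F (a, t)) b :=
      hloc.comp_continuous (g := fun t : ℝ => (a, t)) (by fun_prop)
    refine hl.second_deriv_nonpos (f' := fun t => pdY h (a, t)) (fun t => ?_)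
      (hasDerivAt_pdY hdY a b)
    exact (hasDerivAt_pdY hd a t).add_const (δ * a ^ 2)
  linarith [hsub a b ha hb hb' (by linarith)]

section OpenSet

variable {f k : ℝ × ℝ → ℝ} {s : Set (ℝ × ℝ)}

lemma Set.EqOn.pdX (h : EqOn f k s) (hs : IsOpen s) : EqOn (pdX f) (pdX k) s := by
  intro p hp
  have he : f =ᶠ[𝓝 p] k := h.eventuallyEq_of_mem (hs.mem_nhds hp)
  unfold _root_.pdX
  rw [he.fderiv_eq]

lemma Set.EqOn.pdY (h : EqOn f k s) (hs : IsOpen s) : EqOn (pdY f) (pdY k) s := by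
  intro p hp
  have he : f =ᶠ[𝓝 p] k := h.eventuallyEq_of_mem (hs.mem_nhds hp)
  unfold _root_.pdY
  rw [he.fderiv_eq]

lemma pdX_add {p : ℝ × ℝ} (hf : DifferentiableAt ℝ f p) (hk : DifferentiableAt ℝ k p) :
    pdX (fun q => f q + k q) p = pdX f p + pdX k p := by
  simp [pdX, fderiv_fun_add hf hk]

lemma pdX_sub {p : ℝ × ℝ} (hf : DifferentiableAt ℝ f p) (hk : DifferentiableAt ℝ k p) :
    pdX (fun q => f q - k q) p = pdX f p - pdX k p := by
  simp [pdX, fderiv_fun_sub hf hk]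

lemma pdY_sub {p : ℝ × ℝ} (hf : DifferentiableAt ℝ f p) (hk : DifferentiableAt ℝ k p) :
    pdY (fun q => f q - k q) p = pdY f p - pdY k p := by
  simp [pdY, fderiv_fun_sub hf hk]

lemma pdX_neg (p : ℝ × ℝ) : pdX (fun q => -f q) p = -pdX f p := by
  simp [pdX, fderiv_fun_neg]

lemma pdY_neg (p : ℝ × ℝ) : pdY (fun q => -f q) p = -pdY f p := by
  simp [pdY, fderiv_fun_neg]

lemma pdX_mul {p : ℝ × ℝ} (hf : DifferentiableAt ℝ f p) (hk : DifferentiableAt ℝ k p) :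
    pdX (fun q => f q * k q) p = f p * pdX k p + k p * pdX f p := by
  simp [pdX, fderiv_fun_mul hf hk]

variable {F : ℝ → ℝ} {F' : ℝ} {p : ℝ × ℝ}

lemma pdX_comp (hF : HasDerivAt F F' (f p)) (hf : DifferentiableAt ℝ f p) :
    pdX (fun q => F (f q)) p = F' * pdX f p := by
  have h : HasFDerivAt (fun q => F (f q)) (F' • fderiv ℝ f p) p :=
    hF.comp_hasFDerivAt p hf.hasFDerivAt
  simp [pdX, h.fderiv]

lemma pdY_comp (hF : HasDerivAt F F' (f p)) (hf : DifferentiableAt ℝ f p) :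
    pdY (fun q => F (f q)) p = F' * pdY f p := by
  have h : HasFDerivAt (fun q => F (f q)) (F' • fderiv ℝ f p) p :=
    hF.comp_hasFDerivAt p hf.hasFDerivAt
  simp [pdY, h.fderiv]

end OpenSet

namespace SolitaryWave

variable {g Patm : ℝ} (W : SolitaryWave g Patm)

/-- The open fluid domain. -/
def fluid : Set (ℝ × ℝ) :=
  {p | -W.d < p.2 ∧ p.2 < W.η p.1}

variable {W}

lemma neg_d_lt_η (hne : W.Ωbar.Nonempty) (x : ℝ) : -W.d < W.η x := by
  obtain ⟨q, hq⟩ := hne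
  by_contra! h
  obtain ⟨z, hz⟩ := mem_range_of_exists_le_of_exists_ge W.η_smooth.continuous
    ⟨x, h⟩ ⟨q.1, hq.1.trans hq.2⟩
  have h1 := W.psi_surface z
  rw [hz, W.psi_bed] at h1
  exact W.m_pos.ne' h1

lemma isOpen_fluid : IsOpen W.fluid :=
  (isOpen_lt continuous_const continuous_snd).inter
    (isOpen_lt continuous_snd (W.η_smooth.continuous.comp continuous_fst))

lemma fluid_subset_Ωbar : W.fluid ⊆ W.Ωbar := fun _ h => ⟨h.1.le, h.2.le⟩

lemma Ωbar_subset_closure (hη : ∀ x, -W.d < W.η x) : W.Ωbar ⊆ closure W.fluid := by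
  rintro ⟨x, y⟩ ⟨h1, h2⟩
  have hy : y ∈ closure (Ioo (-W.d) (W.η x)) := by
    rw [closure_Ioo (hη x).ne]
    exact ⟨h1, h2⟩
  exact map_mem_closure (f := fun t : ℝ => (x, t)) (by fun_prop) hy fun t ht => ht

lemma eqOn_Ωbar (hη : ∀ x, -W.d < W.η x) {f k : ℝ × ℝ → ℝ} (h : EqOn f k W.fluid)
    (hf : Continuous f) (hk : Continuous k) : EqOn f k W.Ωbar :=
  (h.closure hf hk).mono (Ωbar_subset_closure hη)

lemma nonneg_on_Ωbar (hη : ∀ x, -W.d < W.η x) {f : ℝ × ℝ → ℝ} (h : ∀ q ∈ W.fluid, 0 ≤ f q)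
    (hf : Continuous f) : ∀ q ∈ W.Ωbar, 0 ≤ f q := fun _ hq =>
  closure_minimal h (isClosed_le continuous_const hf) (Ωbar_subset_closure hη hq)

lemma surface_mem (hη : ∀ x, -W.d < W.η x) (x : ℝ) : (x, W.η x) ∈ W.Ωbar :=
  ⟨(hη x).le, le_rfl⟩

lemma u_neg {q : ℝ × ℝ} (hq : q ∈ W.Ωbar) : W.u q < 0 := by
  obtain ⟨δ, hδ, h⟩ := W.nonstagnant
  linarith [h q.1 q.2 hq.1 hq.2]

/-! ### Regularity of the derivatives of the velocity field -/

lemma u_diff : Differentiable ℝ W.u := W.u_smooth.differentiable (by simp)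
lemma v_diff : Differentiable ℝ W.v := W.v_smooth.differentiable (by simp)
lemma ψ_diff : Differentiable ℝ W.ψ := W.ψ_smooth.differentiable (by simp)
lemma η_diff : Differentiable ℝ W.η := W.η_smooth.differentiable (by simp)
lemma ux_smooth : ContDiff ℝ 2 (pdX W.u) := ContDiff.pdX (n := 2) W.u_smooth
lemma uy_smooth : ContDiff ℝ 2 (pdY W.u) := ContDiff.pdY (n := 2) W.u_smooth
lemma vx_smooth : ContDiff ℝ 2 (pdX W.v) := ContDiff.pdX (n := 2) W.v_smooth
lemma vy_smooth : ContDiff ℝ 2 (pdY W.v) := ContDiff.pdY (n := 2) W.v_smooth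
lemma uxx_smooth : ContDiff ℝ 1 (pdX (pdX W.u)) := ContDiff.pdX (n := 1) W.ux_smooth
lemma uxy_smooth : ContDiff ℝ 1 (pdY (pdX W.u)) := ContDiff.pdY (n := 1) W.ux_smooth
lemma uyy_smooth : ContDiff ℝ 1 (pdY (pdY W.u)) := ContDiff.pdY (n := 1) W.uy_smooth
lemma vxx_smooth : ContDiff ℝ 1 (pdX (pdX W.v)) := ContDiff.pdX (n := 1) W.vx_smooth
lemma vxy_smooth : ContDiff ℝ 1 (pdY (pdX W.v)) := ContDiff.pdY (n := 1) W.vx_smooth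
lemma vyy_smooth : ContDiff ℝ 1 (pdY (pdY W.v)) := ContDiff.pdY (n := 1) W.vy_smooth
lemma ux_diff : Differentiable ℝ (pdX W.u) := W.ux_smooth.differentiable (by simp)
lemma uy_diff : Differentiable ℝ (pdY W.u) := W.uy_smooth.differentiable (by simp)
lemma vx_diff : Differentiable ℝ (pdX W.v) := W.vx_smooth.differentiable (by simp)
lemma vy_diff : Differentiable ℝ (pdY W.v) := W.vy_smooth.differentiable (by simp)

lemma u_comm (q : ℝ × ℝ) : pdX (pdY W.u) q = pdY (pdX W.u) q :=
  pdX_pdY_comm (W.u_smooth.of_le (by norm_cast)) q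

lemma v_comm (q : ℝ × ℝ) : pdX (pdY W.v) q = pdY (pdX W.v) q :=
  pdX_pdY_comm (W.v_smooth.of_le (by norm_cast)) q

/-! ### Consequences of incompressibility -/

lemma vy_eqOn : EqOn (pdY W.v) (fun q => -pdX W.u q) W.fluid := fun q hq => by
  linarith [W.incompressible q.1 q.2 hq.1 hq.2]

lemma vy_eq (hη : ∀ x, -W.d < W.η x) {q : ℝ × ℝ} (hq : q ∈ W.Ωbar) :
    pdY W.v q = -pdX W.u q :=
  eqOn_Ωbar hη vy_eqOn vy_smooth.continuous ux_smooth.continuous.neg hq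

lemma vxy_eqOn : EqOn (pdY (pdX W.v)) (fun q => -pdX (pdX W.u) q) W.fluid := fun q hq => by
  have h := vy_eqOn.pdX isOpen_fluid hq
  rwa [pdX_neg, v_comm] at h

lemma vyy_eqOn : EqOn (pdY (pdY W.v)) (fun q => -pdY (pdX W.u) q) W.fluid := fun q hq => by
  have h := vy_eqOn.pdY isOpen_fluid hq
  rwa [pdY_neg] at h

lemma vxy_eq (hη : ∀ x, -W.d < W.η x) {q : ℝ × ℝ} (hq : q ∈ W.Ωbar) :
    pdY (pdX W.v) q = -pdX (pdX W.u) q :=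
  eqOn_Ωbar hη vxy_eqOn vxy_smooth.continuous uxx_smooth.continuous.neg hq

lemma vyy_eq (hη : ∀ x, -W.d < W.η x) {q : ℝ × ℝ} (hq : q ∈ W.Ωbar) :
    pdY (pdY W.v) q = -pdY (pdX W.u) q :=
  eqOn_Ωbar hη vyy_eqOn vyy_smooth.continuous uxy_smooth.continuous.neg hq

/-! ### The vorticity function along the flow -/

lemma ψ_strictAntiOn (x : ℝ) : StrictAntiOn (fun t => W.ψ (x, t)) (Icc (-W.d) (W.η x)) := by
  refine strictAntiOn_of_deriv_neg (convex_Icc _ _)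
    (W.ψ_smooth.continuous.comp (by fun_prop : Continuous fun t : ℝ => (x, t))).continuousOn ?_
  intro t ht
  rw [interior_Icc] at ht
  rw [(hasDerivAt_pdY ψ_diff x t).deriv, W.psi_y x t ht.1.le ht.2.le]
  exact u_neg ⟨ht.1.le, ht.2.le⟩

lemma ψ_mem_Ioo {q : ℝ × ℝ} (hq : q ∈ W.fluid) : W.ψ q ∈ Ioo 0 W.m := by
  obtain ⟨x, y⟩ := q
  have hq' := fluid_subset_Ωbar hq
  have hlt : -W.d < W.η x := hq.1.trans hq.2
  have h1 := ψ_strictAntiOn x hq' (right_mem_Icc.2 hlt.le) hq.2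
  have h2 := ψ_strictAntiOn x (left_mem_Icc.2 hlt.le) hq' hq.1
  simp only [W.psi_surface, W.psi_bed] at h1 h2
  exact ⟨h1, h2⟩

lemma ψ_mem_Icc (hη : ∀ x, -W.d < W.η x) {q : ℝ × ℝ} (hq : q ∈ W.Ωbar) :
    W.ψ q ∈ Icc 0 W.m := by
  have h : W.fluid ⊆ W.ψ ⁻¹' Icc 0 W.m := fun _ h => Ioo_subset_Icc_self (ψ_mem_Ioo h)
  exact closure_minimal h (isClosed_Icc.preimage W.ψ_smooth.continuous)
    (Ωbar_subset_closure hη hq)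

lemma vorticity_surface (hη : ∀ x, -W.d < W.η x) (x : ℝ) :
    pdX W.v (x, W.η x) - pdY W.u (x, W.η x) = W.γ 0 := by
  have h : EqOn (fun q => pdX W.v q - pdY W.u q) (fun q => W.γ (W.ψ q)) W.Ωbar := by
    refine EqOn.of_subset_closure (s := W.fluid) (fun q hq => W.vorticity_eq q.1 q.2 hq.1 hq.2)
      (vx_smooth.continuous.sub uy_smooth.continuous).continuousOn
      (W.γ_smooth.continuousOn.comp W.ψ_smooth.continuous.continuousOn
        fun q hq => ψ_mem_Icc hη hq) fluid_subset_Ωbar (Ωbar_subset_closure hη)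
  have := h (surface_mem hη x)
  simpa [W.psi_surface] using this

/-- The first derivative of the vorticity function. -/
noncomputable def γ₁ (W : SolitaryWave g Patm) : ℝ → ℝ := derivWithin W.γ (Icc 0 W.m)

/-- The second derivative of the vorticity function. -/
noncomputable def γ₂ (W : SolitaryWave g Patm) : ℝ → ℝ := derivWithin W.γ₁ (Icc 0 W.m)

lemma hasDerivAt_γ {s : ℝ} (hs : s ∈ Ioo 0 W.m) : HasDerivAt W.γ (W.γ₁ s) s :=
  ((W.γ_smooth.differentiableOn (by simp)) s
    (Ioo_subset_Icc_self hs)).hasDerivWithinAt.hasDerivAt (Icc_mem_nhds hs.1 hs.2)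

lemma hasDerivAt_γ₁ {s : ℝ} (hs : s ∈ Ioo 0 W.m) : HasDerivAt W.γ₁ (W.γ₂ s) s :=
  (((W.γ_smooth.derivWithin (m := 1) (uniqueDiffOn_Icc W.m_pos)
    (by norm_num)).differentiableOn (by simp)) s
    (Ioo_subset_Icc_self hs)).hasDerivWithinAt.hasDerivAt (Icc_mem_nhds hs.1 hs.2)

lemma vorticity_eqOn :
    EqOn (fun q => pdX W.v q - pdY W.u q) (fun q => W.γ (W.ψ q)) W.fluid :=
  fun q hq => W.vorticity_eq q.1 q.2 hq.1 hq.2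

lemma laplacian_u : EqOn (fun q => pdX (pdX W.u) q + pdY (pdY W.u) q)
    (fun q => -(W.γ₁ (W.ψ q) * W.u q)) W.fluid := by
  intro q hq
  have h := vorticity_eqOn.pdY isOpen_fluid hq
  rw [pdY_sub (vx_diff q) (uy_diff q), pdY_comp (hasDerivAt_γ (ψ_mem_Ioo hq)) (ψ_diff q),
    vxy_eqOn hq, W.psi_y q.1 q.2 hq.1.le hq.2.le] at h
  simp only at h ⊢
  linarith

lemma laplacian_v : EqOn (fun q => pdX (pdX W.v) q + pdY (pdY W.v) q)
    (fun q => -(W.γ₁ (W.ψ q) * W.v q)) W.fluid := by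
  intro q hq
  have h := vorticity_eqOn.pdX isOpen_fluid hq
  rw [pdX_sub (vx_diff q) (uy_diff q), pdX_comp (hasDerivAt_γ (ψ_mem_Ioo hq)) (ψ_diff q),
    u_comm, W.psi_x q.1 q.2 hq.1.le hq.2.le] at h
  have h2 := vyy_eqOn hq
  simp only at h h2 ⊢
  linarith

lemma laplacian_ux : EqOn (fun q => pdX (pdX (pdX W.u)) q + pdY (pdY (pdX W.u)) q)
    (fun q => W.γ₂ (W.ψ q) * W.v q * W.u q - W.γ₁ (W.ψ q) * pdX W.u q) W.fluid := by
  intro q hq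
  have h := laplacian_u.pdX isOpen_fluid hq
  have hψ := hasDerivAt_γ₁ (ψ_mem_Ioo hq)
  have hγd : DifferentiableAt ℝ (fun q => W.γ₁ (W.ψ q)) q :=
    hψ.differentiableAt.comp q (ψ_diff q)
  have hcomm : pdX (pdY (pdY W.u)) q = pdY (pdY (pdX W.u)) q := by
    rw [pdX_pdY_comm uy_smooth, show pdX (pdY W.u) = pdY (pdX W.u) from funext u_comm]
  rw [pdX_add (uxx_smooth.differentiable (by simp) q) (uyy_smooth.differentiable (by simp) q),
    pdX_neg, pdX_mul hγd (u_diff q), pdX_comp hψ (ψ_diff q),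
    W.psi_x q.1 q.2 hq.1.le hq.2.le, hcomm] at h
  simp only at h ⊢
  linarith

/-! ### The free surface -/

lemma hasDerivAt_surface {f : ℝ × ℝ → ℝ} (hf : Differentiable ℝ f) (x : ℝ) :
    HasDerivAt (fun t => f (t, W.η t))
      (pdX f (x, W.η x) + deriv W.η x * pdY f (x, W.η x)) x := by
  simpa using hasDerivAt_comp_curve hf (hasDerivAt_id x) (W.η_diff x).hasDerivAt

lemma bernoulli_surface (hη : ∀ x, -W.d < W.η x) (x : ℝ) :
    let q := (x, W.η x)
    W.u q * (W.u q * pdX W.u q + W.v q * pdY W.u q)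
      + W.v q * (W.u q * pdX W.v q - W.v q * pdX W.u q) + g * W.v q = 0 := by
  intro q
  have hq : q ∈ W.Ωbar := surface_mem hη x
  have hPx : Continuous (pdX W.P) := (ContDiff.pdX (n := 2) W.P_smooth).continuous
  have hPy : Continuous (pdY W.P) := (ContDiff.pdY (n := 2) W.P_smooth).continuous
  have hu := W.u_smooth.continuous
  have hv := W.v_smooth.continuous
  have hux := W.ux_smooth.continuous
  have huy := W.uy_smooth.continuous
  have hvx := W.vx_smooth.continuous
  have hvy := W.vy_smooth.continuous
  have e1 := eqOn_Ωbar (W := W) hη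
    (f := fun q => W.u q * pdX W.u q + W.v q * pdY W.u q) (k := fun q => -pdX W.P q)
    (fun q hq => W.euler_x q.1 q.2 hq.1 hq.2) (by fun_prop) (by fun_prop) hq
  have e2 := eqOn_Ωbar (W := W) hη
    (f := fun q => W.u q * pdX W.v q + W.v q * pdY W.v q) (k := fun q => -pdY W.P q - g)
    (fun q hq => W.euler_y q.1 q.2 hq.1 hq.2) (by fun_prop) (by fun_prop) hq
  have hP := (hasDerivAt_surface (W := W) (W.P_smooth.differentiable (by simp)) x).unique
    ((hasDerivAt_const x Patm).congr_of_eventuallyEq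
      (Eventually.of_forall fun t => W.surface_pressure t))
  have hk := W.surface_kinematic x
  have hvy' := vy_eq hη hq
  simp only at e1 e2
  change pdX W.P q + deriv W.η x * pdY W.P q = 0 at hP
  change W.v q = deriv W.η x * W.u q at hk
  linear_combination W.u q * e1 + W.v q * e2 - W.u q * hP - W.v q * W.v q * hvy'
    - pdY W.P q * hk

lemma bernoulli_surface_deriv (hη : ∀ x, -W.d < W.η x) (x : ℝ) {c : ℝ}
    (hcu : pdX (pdX W.u) (x, W.η x) + pdY (pdY W.u) (x, W.η x) = c * W.u (x, W.η x))
    (hcv : pdX (pdX W.v) (x, W.η x) + pdY (pdY W.v) (x, W.η x) = c * W.v (x, W.η x)) :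
    let q := (x, W.η x)
    (W.u q * pdX W.u q + W.v q * pdY W.u q) ^ 2
      + (W.u q * pdX W.v q - W.v q * pdX W.u q) ^ 2
      + W.u q * ((W.u q * pdX W.u q + W.v q * pdY W.u q) * pdX W.u q
        + (W.u q * pdX W.v q - W.v q * pdX W.u q) * pdY W.u q
        + (W.u q ^ 2 * pdX (pdX W.u) q + 2 * W.u q * W.v q * pdY (pdX W.u) q
          + W.v q ^ 2 * (c * W.u q - pdX (pdX W.u) q)))
      + W.v q * ((W.u q * pdX W.u q + W.v q * pdY W.u q) * pdX W.v q
        - (W.u q * pdX W.v q - W.v q * pdX W.u q) * pdX W.u q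
        + (W.u q ^ 2 * (c * W.v q + pdY (pdX W.u) q) - 2 * W.u q * W.v q * pdX (pdX W.u) q
          - W.v q ^ 2 * pdY (pdX W.u) q))
      + g * (W.u q * pdX W.v q - W.v q * pdX W.u q) = 0 := by
  intro q
  have hq : q ∈ W.Ωbar := surface_mem hη x
  have dU := hasDerivAt_surface (W := W) W.u_diff x
  have dV := hasDerivAt_surface (W := W) W.v_diff x
  have dp := hasDerivAt_surface (W := W) W.ux_diff x
  have da := hasDerivAt_surface (W := W) W.uy_diff x
  have db := hasDerivAt_surface (W := W) W.vx_diff x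
  have h := (((dU.fun_mul ((dU.fun_mul dp).fun_add (dV.fun_mul da))).fun_add
    (dV.fun_mul ((dU.fun_mul db).fun_sub (dV.fun_mul dp)))).fun_add (dV.const_mul g)).unique
    ((hasDerivAt_const x (0 : ℝ)).congr_of_eventuallyEq
      (Eventually.of_forall fun t => bernoulli_surface hη t))
  have hk := W.surface_kinematic x
  have hvy := vy_eq hη hq
  have hvxy := vxy_eq hη hq
  have hvyy := vyy_eq hη hq
  have huxy := W.u_comm q
  change pdX (pdX W.u) q + pdY (pdY W.u) q = c * W.u q at hcu
  change pdX (pdX W.v) q + pdY (pdY W.v) q = c * W.v q at hcv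
  change W.v q = deriv W.η x * W.u q at hk
  rw [show (x, W.η x) = q from rfl] at h
  generalize deriv W.η x = e at *
  rw [hvy, hvxy, huxy, eq_sub_of_add_eq' hcu, eq_sub_of_add_eq hcv, hvyy] at h
  generalize W.u q = u at *
  generalize W.v q = v at *
  subst hk
  linear_combination u * h

/-- The Laplacians of `u` and `v` on the surface have the same nonnegative coefficient. -/
lemma exists_laplacian_coeff (hη : ∀ x, -W.d < W.η x)
    (hγ₁ : ∀ s ∈ Icc (0 : ℝ) W.m, W.γ₁ s ≤ 0) {q : ℝ × ℝ} (hq : q ∈ W.Ωbar) :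
    ∃ c ≥ 0, pdX (pdX W.u) q + pdY (pdY W.u) q = c * W.u q ∧
      pdX (pdX W.v) q + pdY (pdY W.v) q = c * W.v q := by
  have hu := W.u_smooth.continuous
  have hv := W.v_smooth.continuous
  have huxx := W.uxx_smooth.continuous
  have huyy := W.uyy_smooth.continuous
  have hvxx := W.vxx_smooth.continuous
  have hvyy := W.vyy_smooth.continuous
  have h1 := eqOn_Ωbar (W := W) hη
    (f := fun q => W.v q * (pdX (pdX W.u) q + pdY (pdY W.u) q))
    (k := fun q => W.u q * (pdX (pdX W.v) q + pdY (pdY W.v) q))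
    (fun q hq => by
      have hu := laplacian_u hq
      have hv := laplacian_v hq
      simp only at hu hv ⊢
      rw [hu, hv]
      ring) (by fun_prop) (by fun_prop) hq
  have h2 := nonneg_on_Ωbar (W := W) hη
    (f := fun q => W.u q * (pdX (pdX W.u) q + pdY (pdY W.u) q))
    (fun q hq => by
      have hu := laplacian_u hq
      simp only at hu ⊢
      rw [hu]
      nlinarith [hγ₁ _ (Ioo_subset_Icc_self (ψ_mem_Ioo hq)), sq_nonneg (W.u q)])
    (by fun_prop) q hq
  have hun := u_neg hq
  simp only at h1 h2
  refine ⟨(pdX (pdX W.u) q + pdY (pdY W.u) q) / W.u q, ?_, ?_, ?_⟩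
  · exact div_nonneg_of_nonpos (by nlinarith) hun.le
  · rw [div_mul_cancel₀ _ hun.ne]
  · rw [div_mul_eq_mul_div, eq_div_iff hun.ne]
    linarith

/-! ### Signs and boundary values -/

lemma v_axis (y : ℝ) : W.v (0, y) = 0 := by
  have := W.v_odd 0 y
  rw [neg_zero] at this
  linarith

lemma ux_axis (y : ℝ) : pdX W.u (0, y) = 0 := by
  have h := hasDerivAt_pdX (W.u_diff) 0 y
  have h' : HasDerivAt (fun t => W.u (t, y)) (-pdX W.u (0, y)) 0 := by
    have h2 : HasDerivAt (fun t => W.u (-t, y)) (-pdX W.u (0, y)) 0 := by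
      simpa using hasDerivAt_comp_curve W.u_diff (hasDerivAt_neg (0 : ℝ)) (hasDerivAt_const 0 y)
    simpa only [W.u_even] using h2
  linarith [h.unique h']

lemma v_nonneg (hM : W.MonotoneHalf) {x y : ℝ} (hx : 0 ≤ x) (hq : (x, y) ∈ W.Ωbar) :
    0 ≤ W.v (x, y) := by
  rcases hx.eq_or_lt with rfl | hx
  · rw [v_axis]
  rcases hq.1.eq_or_lt with h | h
  · simp only at h
    rw [← h, W.bed_kinematic]
  rcases hq.2.eq_or_lt with h' | h'
  · exact (hM _ (Or.inr ⟨hx, h'⟩)).le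
  · exact (hM _ (Or.inl ⟨hx, h, h'⟩)).le

lemma ux_bed_nonpos (hη : ∀ x, -W.d < W.η x) (hM : W.MonotoneHalf) {x : ℝ} (hx : 0 ≤ x) :
    pdX W.u (x, -W.d) ≤ 0 := by
  have h := HasDerivAt.nonneg_of_nonneg_right (hη x) (hasDerivAt_pdY W.v_diff x (-W.d))
    (W.bed_kinematic x) fun y h1 h2 => v_nonneg hM hx ⟨h1.le, h2.le⟩
  rw [vy_eq hη ⟨le_rfl, (hη x).le⟩] at h
  linarith

/-! ### Decay -/

lemma v_decay (W : SolitaryWave g Patm) {ε : ℝ} (hε : 0 < ε) :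
    ∃ X, ∀ x ≥ X, ∀ y, -W.d ≤ y → y ≤ W.η x → |W.v (x, y)| ≤ ε := by
  obtain ⟨R, hR⟩ := W.asymptotic ε hε
  exact ⟨R, fun x hx y h1 h2 => (hR x y (hx.le.trans (le_abs_self x)) h1 h2).2.1.le⟩

lemma ux_decay (W : SolitaryWave g Patm) {ε : ℝ} (hε : 0 < ε) :
    ∃ X, ∀ x ≥ X, ∀ y, -W.d ≤ y → y ≤ W.η x → |pdX W.u (x, y)| ≤ ε := by
  obtain ⟨R, hR⟩ := W.asymptotic ε hε
  exact ⟨R, fun x hx y h1 h2 =>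
    (hR x y (hx.le.trans (le_abs_self x)) h1 h2).2.2.2.2.2.2.2.2.1.le⟩

lemma η_tendsto (hη : ∀ x, -W.d < W.η x) : Tendsto W.η atTop (𝓝 0) := by
  rw [Metric.tendsto_atTop]
  intro ε hε
  obtain ⟨R, hR⟩ := W.asymptotic ε hε
  exact ⟨R, fun x hx => by
    simpa using (hR x (W.η x) (hx.le.trans (le_abs_self x)) (hη x).le le_rfl).1⟩

lemma v_surface_tendsto (hη : ∀ x, -W.d < W.η x) :
    Tendsto (fun x => W.v (x, W.η x)) atTop (𝓝 0) := by
  rw [Metric.tendsto_atTop]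
  intro ε hε
  obtain ⟨R, hR⟩ := W.asymptotic ε hε
  exact ⟨R, fun x hx => by
    simpa using (hR x (W.η x) (hx.le.trans (le_abs_self x)) (hη x).le le_rfl).2.1⟩

lemma u_surface_tendsto (hη : ∀ x, -W.d < W.η x) :
    Tendsto (fun x => W.u (x, W.η x)) atTop (𝓝 (W.uInf 0)) := by
  have h1 : Tendsto (fun x => W.u (x, W.η x) - W.uInf (W.η x)) atTop (𝓝 0) := by
    rw [Metric.tendsto_atTop]
    intro ε hε
    obtain ⟨R, hR⟩ := W.asymptotic ε hε
    exact ⟨R, fun x hx => by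
      simpa using
        (hR x (W.η x) (hx.le.trans (le_abs_self x)) (hη x).le le_rfl).2.2.2.2.2.2.2.1⟩
  have h2 : Tendsto (fun x => W.uInf (W.η x)) atTop (𝓝 (W.uInf 0)) :=
    (W.uInf_smooth.continuous.tendsto 0).comp (η_tendsto hη)
  simpa using h1.add h2

lemma uInf_nonpos (hη : ∀ x, -W.d < W.η x) : W.uInf 0 ≤ 0 :=
  le_of_tendsto' (u_surface_tendsto hη) fun x => (u_neg (surface_mem hη x)).le

lemma η_nonneg (hη : ∀ x, -W.d < W.η x) (hM : W.MonotoneHalf) {x : ℝ} (hx : 0 ≤ x) :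
    0 ≤ W.η x := by
  have hanti : AntitoneOn W.η (Ici 0) := by
    refine antitoneOn_of_deriv_nonpos (convex_Ici 0) W.η_smooth.continuous.continuousOn
      W.η_diff.differentiableOn fun t ht => ?_
    rw [interior_Ici] at ht
    have hv := v_nonneg hM (le_of_lt ht) (surface_mem hη t)
    rw [W.surface_kinematic] at hv
    nlinarith [u_neg (surface_mem hη t)]
  refine le_of_tendsto (η_tendsto hη) ?_
  filter_upwards [eventually_ge_atTop x] with t ht
  exact hanti hx (hx.trans ht) ht

lemma speed_le (hη : ∀ x, -W.d < W.η x) (hg : 0 < g) (hM : W.MonotoneHalf) {x : ℝ}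
    (hx : 0 ≤ x) : W.u (x, W.η x) ^ 2 + W.v (x, W.η x) ^ 2 ≤ W.uInf 0 ^ 2 := by
  set B : ℝ → ℝ := fun t =>
    W.u (t, W.η t) * W.u (t, W.η t) + W.v (t, W.η t) * W.v (t, W.η t) + 2 * g * W.η t with hB
  have hd : ∀ t, HasDerivAt B 0 t := by
    intro t
    have dU := hasDerivAt_surface (W := W) W.u_diff t
    have dV := hasDerivAt_surface (W := W) W.v_diff t
    refine (((dU.fun_mul dU).fun_add (dV.fun_mul dV)).fun_add
      ((W.η_diff t).hasDerivAt.const_mul (2 * g))).congr_deriv ?_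
    have hb := bernoulli_surface hη t
    have hk := W.surface_kinematic t
    have hvy := vy_eq hη (surface_mem hη t)
    have hu := (u_neg (surface_mem hη t)).ne
    refine mul_left_cancel₀ hu ?_
    simp only at hb
    rw [hvy]
    rw [hk] at hb ⊢
    linear_combination 2 * hb
  have hconst : ∀ t, B t = B x := fun t =>
    is_const_of_deriv_eq_zero (fun s => (hd s).differentiableAt) (fun s => (hd s).deriv) t x
  have hlim : Tendsto B atTop (𝓝 (W.uInf 0 * W.uInf 0 + 0 * 0 + 2 * g * 0)) :=
    (((u_surface_tendsto hη).mul (u_surface_tendsto hη)).add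
      ((v_surface_tendsto hη).mul (v_surface_tendsto hη))).add ((η_tendsto hη).const_mul _)
  have hBx : B x = W.uInf 0 * W.uInf 0 + 0 * 0 + 2 * g * 0 := by
    refine tendsto_nhds_unique ?_ hlim
    rw [funext hconst]
    exact tendsto_const_nhds
  simp only [hB] at hBx
  nlinarith [mul_nonneg hg.le (η_nonneg hη hM hx)]

lemma γ_zero_sq_mul_speed_le (hη : ∀ x, -W.d < W.η x) (hg : 0 < g) (hM : W.MonotoneHalf)
    (hγ0 : W.γ 0 ≤ 0) (hsurf : 0 < g - W.γ 0 * W.uInf 0) {x : ℝ} (hx : 0 ≤ x) :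
    W.γ 0 ^ 2 * (W.u (x, W.η x) ^ 2 + W.v (x, W.η x) ^ 2) ≤ g ^ 2 := by
  have h1 := mul_le_mul_of_nonneg_left (speed_le hη hg hM hx) (sq_nonneg (W.γ 0))
  have h2 : 0 ≤ W.γ 0 * W.uInf 0 := mul_nonneg_of_nonpos_of_nonpos hγ0 (uInf_nonpos hη)
  nlinarith

/-- The linear combination of `u_x`, `v` and `u` compared by the maximum principle. -/
noncomputable def comparison (W : SolitaryWave g Patm) (α β σ : ℝ) (q : ℝ × ℝ) : ℝ :=
  α * pdX W.u q + β * W.v q + σ * W.u q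

lemma comparison_smooth (α β σ : ℝ) : ContDiff ℝ 2 (W.comparison α β σ) :=
  ((contDiff_const.mul W.ux_smooth).add
    (contDiff_const.mul (W.v_smooth.of_le (by norm_cast)))).add
    (contDiff_const.mul (W.u_smooth.of_le (by norm_cast)))

lemma pdX_comparison (α β σ : ℝ) : pdX (W.comparison α β σ) =
    fun q => α * pdX (pdX W.u) q + β * pdX W.v q + σ * pdX W.u q :=
  pdX_lin_comb W.ux_diff W.v_diff W.u_diff α β σ

lemma pdY_comparison (α β σ : ℝ) : pdY (W.comparison α β σ) =
    fun q => α * pdY (pdX W.u) q + β * pdY W.v q + σ * pdY W.u q :=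
  pdY_lin_comb W.ux_diff W.v_diff W.u_diff α β σ

lemma laplacian_comparison (α β σ : ℝ) {q : ℝ × ℝ} (hq : q ∈ W.fluid) :
    pdX (pdX (W.comparison α β σ)) q + pdY (pdY (W.comparison α β σ)) q =
      α * (W.γ₂ (W.ψ q) * W.v q * W.u q) - W.γ₁ (W.ψ q) * W.comparison α β σ q := by
  rw [pdX_comparison, pdY_comparison,
    pdX_lin_comb (W.uxx_smooth.differentiable (by simp)) W.vx_diff W.ux_diff,
    pdY_lin_comb (W.uxy_smooth.differentiable (by simp)) W.vy_diff W.uy_diff]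
  have h1 := laplacian_u hq
  have h2 := laplacian_v hq
  have h3 := laplacian_ux hq
  simp only [comparison] at h1 h2 h3 ⊢
  linear_combination α * h3 + β * h2 + σ * h1

/-- The maximum principle for `comparison`. -/
lemma comparison_nonpos (hη : ∀ x, -W.d < W.η x) (hM : W.MonotoneHalf)
    (hγ₁ : ∀ s ∈ Icc (0 : ℝ) W.m, W.γ₁ s ≤ 0) (hγ₂ : ∀ s ∈ Icc (0 : ℝ) W.m, W.γ₂ s ≤ 0)
    {α β σ : ℝ} (hα : 0 ≤ α) (hσ : 0 ≤ σ)
    (htop : ∀ x ≥ 0, W.comparison α β σ (x, W.η x) ≤ 0) :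
    ∀ x ≥ 0, ∀ y, -W.d ≤ y → y ≤ W.η x → W.comparison α β σ (x, y) ≤ 0 := by
  refine nonpos_of_subharmonic_where_pos (comparison_smooth α β σ) W.η_smooth.continuous
    (fun y h1 h2 => ?_) (fun x hx => ?_) htop (fun ε hε => ?_) (fun x y hx h1 h2 hpos => ?_)
  · simp only [comparison, v_axis, ux_axis]
    nlinarith [u_neg (W := W) (q := (0, y)) ⟨h1, h2⟩]
  · simp only [comparison, W.bed_kinematic]
    nlinarith [u_neg (W := W) (q := (x, -W.d)) ⟨le_rfl, (hη x).le⟩,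
      mul_nonpos_of_nonneg_of_nonpos hα (ux_bed_nonpos hη hM hx)]
  · have hN : 0 < α + |β| + 1 := by positivity
    obtain ⟨X, hX⟩ := W.ux_decay (div_pos hε hN)
    obtain ⟨Y, hY⟩ := W.v_decay (div_pos hε hN)
    refine ⟨max X Y, fun x hx y h1 h2 => ?_⟩
    have e1 := hX x ((le_max_left _ _).trans hx) y h1 h2
    have e2 := hY x ((le_max_right _ _).trans hx) y h1 h2
    set ε' := ε / (α + |β| + 1) with hε'
    have e : (α + |β| + 1) * ε' = ε := by rw [hε']; field_simp
    have hε'0 : 0 < ε' := div_pos hε hN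
    have a1 : α * pdX W.u (x, y) ≤ α * ε' :=
      mul_le_mul_of_nonneg_left ((le_abs_self _).trans e1) hα
    have a2 : β * W.v (x, y) ≤ |β| * ε' := by
      refine (le_abs_self _).trans ?_
      rw [abs_mul]
      exact mul_le_mul_of_nonneg_left e2 (abs_nonneg _)
    have a3 : σ * W.u (x, y) ≤ 0 :=
      mul_nonpos_of_nonneg_of_nonpos hσ (u_neg (W := W) (q := (x, y)) ⟨h1, h2⟩).le
    simp only [comparison]
    linarith
  · have hq : (x, y) ∈ W.fluid := ⟨h1, h2⟩
    have hψ := Ioo_subset_Icc_self (ψ_mem_Ioo hq)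
    rw [laplacian_comparison α β σ hq]
    have hv := v_nonneg hM hx.le (fluid_subset_Ωbar hq)
    have hu := u_neg (fluid_subset_Ωbar hq)
    have e1 : 0 ≤ W.γ₂ (W.ψ (x, y)) * W.v (x, y) * W.u (x, y) :=
      mul_nonneg_of_nonpos_of_nonpos (mul_nonpos_of_nonpos_of_nonneg (hγ₂ _ hψ) hv) hu.le
    nlinarith [mul_nonneg hα e1, hγ₁ _ hψ]

lemma surface_continuous {f : ℝ × ℝ → ℝ} (hf : Continuous f) :
    Continuous fun x => f (x, W.η x) :=
  hf.comp (continuous_id.prodMk W.η_smooth.continuous)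

/-- On a monotone wave, `u_x` is negative on the right half of the surface. -/
lemma ux_surface_neg (hη : ∀ x, -W.d < W.η x) (hg : 0 < g) (hM : W.MonotoneHalf)
    (hγ : W.γ 0 ≤ 0)
    (hγ₁ : ∀ s ∈ Icc (0 : ℝ) W.m, W.γ₁ s ≤ 0) (hγ₂ : ∀ s ∈ Icc (0 : ℝ) W.m, W.γ₂ s ≤ 0)
    (hsurf : 0 < g - W.γ 0 * W.uInf 0) {x₁ : ℝ} (hx₁ : 0 < x₁) :
    pdX W.u (x₁, W.η x₁) < 0 := by
  by_contra! hp₁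
  obtain ⟨δ, hδ, hδu⟩ := W.nonstagnant
  set N : ℝ → ℝ := fun x => |W.v (x, W.η x)| - 1 / 32 * W.u (x, W.η x) with hN
  have hNδ : ∀ x, δ / 32 ≤ N x := fun x => by
    have := hδu x (W.η x) (hη x).le le_rfl
    have := abs_nonneg (W.v (x, W.η x))
    simp only [hN]
    linarith
  have hN0 : ∀ x, 0 < N x := fun x => lt_of_lt_of_le (by positivity) (hNδ x)
  set ρ : ℝ → ℝ := fun x => pdX W.u (x, W.η x) / N x with hρ
  have hρc : Continuous ρ := (surface_continuous W.ux_smooth.continuous).div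
    ((surface_continuous W.v_smooth.continuous).abs.sub
      ((surface_continuous W.u_smooth.continuous).const_mul _)) fun x => (hN0 x).ne'
  obtain ⟨x₀, hx₀, hρ₁, hmax⟩ := exists_pos_max_of_decay hρc (by simp [hρ, ux_axis])
    (fun ε hε => by
      obtain ⟨X, hX⟩ := W.ux_decay (show 0 < ε * (δ / 32) by positivity)
      refine ⟨X, fun x hx => ?_⟩
      have h1 := (le_abs_self _).trans (hX x hx (W.η x) (hη x).le le_rfl)
      rw [hρ]
      simp only
      rw [div_le_iff₀ (hN0 x)]
      exact h1.trans (mul_le_mul_of_nonneg_left (hNδ x) hε.le))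
    hx₁ (div_nonneg hp₁ (hN0 x₁).le)
  set R := ρ x₀ with hR
  have hR0 : 0 ≤ R := le_trans (div_nonneg hp₁ (hN0 x₁).le) hρ₁
  have hNv : ∀ x ≥ 0, N x = W.v (x, W.η x) - 1 / 32 * W.u (x, W.η x) := fun x hx => by
    simp only [hN]
    rw [abs_of_nonneg (v_nonneg hM hx (surface_mem hη x))]
  have htop : ∀ x ≥ 0, W.comparison 1 (-R) (R / 32) (x, W.η x) ≤ 0 := fun x hx => by
    have h := hmax x hx
    rw [hρ] at h
    simp only at h
    rw [div_le_iff₀ (hN0 x), hNv x hx] at h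
    simp only [comparison]
    linarith
  have hneg := comparison_nonpos hη hM hγ₁ hγ₂ zero_le_one (by positivity : 0 ≤ R / 32) htop
  have hq := surface_mem hη x₀
  have hp : pdX W.u (x₀, W.η x₀) =
      R * (W.v (x₀, W.η x₀) - 1 / 32 * W.u (x₀, W.η x₀)) := by
    rw [← hNv x₀ hx₀.le, hR, hρ]
    simp only
    rw [div_mul_cancel₀ _ (hN0 x₀).ne']
  have h0 : W.comparison 1 (-R) (R / 32) (x₀, W.η x₀) = 0 := by
    simp only [comparison]
    linarith
  have hd : Differentiable ℝ (W.comparison 1 (-R) (R / 32)) :=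
    (comparison_smooth 1 (-R) (R / 32)).differentiable (by simp)
  have htan := IsLocalMax.hasDerivAt_eq_zero (f := fun t => W.comparison 1 (-R) (R / 32) (t, W.η t))
    (by
      filter_upwards [Ioi_mem_nhds hx₀] with t ht
      rw [h0]
      exact htop t (le_of_lt ht)) (hasDerivAt_surface hd x₀)
  have hnor := HasDerivAt.nonneg_of_nonpos_left (hη x₀) (hasDerivAt_pdY hd x₀ (W.η x₀)) h0
    fun y h1 h2 => hneg x₀ hx₀.le y h1.le h2.le
  rw [pdX_comparison, pdY_comparison] at htan
  rw [pdY_comparison] at hnor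
  simp only [vy_eq hη hq] at htan hnor
  have hu := u_neg hq
  have hv : 0 < W.v (x₀, W.η x₀) := hM _ (Or.inr ⟨hx₀, rfl⟩)
  have hk := W.surface_kinematic x₀
  obtain ⟨c, hc, hcu, hcv⟩ := exists_laplacian_coeff hη hγ₁ hq
  have hB1 := bernoulli_surface hη x₀
  have hB2 := bernoulli_surface_deriv hη x₀ hcu hcv
  have hγg := γ_zero_sq_mul_speed_le hη hg hM hγ hsurf hx₀.le
  have hvort := vorticity_surface hη x₀
  simp only at hB1 hB2
  generalize W.u (x₀, W.η x₀) = u at *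
  generalize W.v (x₀, W.η x₀) = v at *
  generalize deriv W.η x₀ = e at *
  generalize pdX (pdX W.u) (x₀, W.η x₀) = A at *
  generalize pdY (pdX W.u) (x₀, W.η x₀) = C at *
  generalize pdX W.u (x₀, W.η x₀) = p at *
  generalize pdY W.u (x₀, W.η x₀) = a at *
  generalize pdX W.v (x₀, W.η x₀) = b at *
  have hT : u * A + v * C = R * (u * b - v * p - 1 / 32 * (u * p + v * a)) := by
    rw [hk]
    linear_combination u * htan
  have hN' : R * (v * b + u * p - 1 / 32 * (v * p - u * a)) ≤ v * A - u * C := by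
    have h1 : 0 ≤ (-u * (1 + e ^ 2)) * (1 * C + -R * -p + R / 32 * a) :=
      mul_nonneg (mul_nonneg (by linarith) (by positivity)) hnor
    rw [hk]
    linear_combination h1 - e * u * htan
  exact touching_false hu hv hg hc hR0 hp hvort hγ hγg hB1 hT hN' hB2

/-- The slope of the surface of a monotone wave is bounded by some `T < 1`. -/
lemma exists_surface_slope_bound (hη : ∀ x, -W.d < W.η x) (hg : 0 < g) (hM : W.MonotoneHalf)
    (hγ : W.γ 0 ≤ 0)
    (hγ₁ : ∀ s ∈ Icc (0 : ℝ) W.m, W.γ₁ s ≤ 0) (hγ₂ : ∀ s ∈ Icc (0 : ℝ) W.m, W.γ₂ s ≤ 0)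
    (hsurf : 0 < g - W.γ 0 * W.uInf 0) :
    ∃ T ≥ 0, T < 1 ∧ ∀ x ≥ 0, W.v (x, W.η x) + T * W.u (x, W.η x) ≤ 0 := by
  obtain ⟨δ, hδ, hδu⟩ := W.nonstagnant
  have hu : ∀ x, 0 < -W.u (x, W.η x) := fun x => neg_pos.2 (u_neg (surface_mem hη x))
  set ρ : ℝ → ℝ := fun x => W.v (x, W.η x) / -W.u (x, W.η x) with hρ
  have hρc : Continuous ρ := (surface_continuous W.v_smooth.continuous).div
    (surface_continuous W.u_smooth.continuous).neg fun x => (hu x).ne'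
  have h1 : 0 ≤ ρ 1 := div_nonneg (v_nonneg hM zero_le_one (surface_mem hη 1)) (hu 1).le
  obtain ⟨x₀, hx₀, hρ₁, hmax⟩ := exists_pos_max_of_decay hρc (by simp [hρ, v_axis])
    (fun ε hε => by
      obtain ⟨X, hX⟩ := W.v_decay (show 0 < ε * δ by positivity)
      refine ⟨X, fun x hx => ?_⟩
      have h1 := (le_abs_self _).trans (hX x hx (W.η x) (hη x).le le_rfl)
      rw [hρ]
      simp only
      rw [div_le_iff₀ (hu x)]
      have := hδu x (W.η x) (hη x).le le_rfl
      exact h1.trans (mul_le_mul_of_nonneg_left (by linarith) hε.le))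
    zero_lt_one h1
  refine ⟨ρ x₀, h1.trans hρ₁, ?_, fun x hx => ?_⟩
  · by_contra! hge
    have hq := surface_mem hη x₀
    have hun := u_neg hq
    have hdv := hasDerivAt_surface (W := W) W.v_diff x₀
    have hdu := hasDerivAt_surface (W := W) W.u_diff x₀
    have hd := IsLocalMax.hasDerivAt_eq_zero (f := ρ)
      (by
        filter_upwards [Ioi_mem_nhds hx₀] with t ht
        exact hmax t (le_of_lt ht)) (hdv.fun_div hdu.fun_neg (hu x₀).ne')
    rw [div_eq_zero_iff, or_iff_left (pow_ne_zero 2 (hu x₀).ne'), vy_eq hη hq] at hd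
    have huv : -W.u (x₀, W.η x₀) ≤ W.v (x₀, W.η x₀) := by
      have := (le_div_iff₀ (hu x₀)).1 hge
      linarith
    have hp := ux_surface_neg hη hg hM hγ hγ₁ hγ₂ hsurf hx₀
    have hk := W.surface_kinematic x₀
    have hB1 := bernoulli_surface hη x₀
    have hvort := vorticity_surface hη x₀
    simp only at hB1
    refine slope_max_false hun hg hp (hvort.trans_le hγ) huv hB1 ?_
    rw [hk] at hd ⊢
    linear_combination -W.u (x₀, W.η x₀) * hd
  · have h := hmax x hx
    have h' := (div_le_iff₀ (hu x)).1 h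
    linarith

lemma abs_v_lt_abs_u (hg : 0 < g) (hW : W.MemW) (hsurf : 0 < g - W.γ 0 * W.uInf 0)
    {q : ℝ × ℝ} (hq : q ∈ W.Ωbar) : |W.v q| < |W.u q| := by
  have hη := neg_d_lt_η ⟨q, hq⟩
  obtain ⟨hγ, hγ₁, hγ₂, ht | hM⟩ := hW
  · rw [ht.1 q, abs_zero, abs_pos]
    exact (u_neg hq).ne
  have h0 : (0 : ℝ) ∈ Icc 0 W.m := ⟨le_rfl, W.m_pos.le⟩
  obtain ⟨T, hT0, hT1, hT⟩ := exists_surface_slope_bound hη hg hM (hγ 0 h0) hγ₁ hγ₂ hsurf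
  have hright : ∀ x ≥ 0, ∀ y, (x, y) ∈ W.Ωbar → |W.v (x, y)| < |W.u (x, y)| := by
    intro x hx y hxy
    have h := comparison_nonpos hη hM hγ₁ hγ₂ (α := 0) (β := 1) le_rfl hT0
      (fun x hx => by simpa [comparison] using hT x hx) x hx y hxy.1 hxy.2
    simp only [comparison, zero_mul, one_mul, zero_add] at h
    have hu := u_neg hxy
    rw [abs_of_nonneg (v_nonneg hM hx hxy), abs_of_neg hu]
    nlinarith
  obtain ⟨x, y⟩ := q
  rcases le_total 0 x with hx | hx
  · exact hright x hx y hq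
  · have := hright (-x) (by linarith) y ⟨hq.1, by simpa [W.η_even] using hq.2⟩
    rwa [W.v_odd, W.u_even, abs_neg] at this

end SolitaryWave

end

/-- **Theorem (bound on the slope, solitary case).**  Let `𝓜 ⊆ 𝒲` be a set of solitary
waves whose trace image `τ(𝓜)` is a connected subset of the space of bounded continuous
functions `[0,∞) → ℝ⁷` with the supremum metric.  If `𝓜` contains a trivial wave and
every wave of `𝓜` satisfies `g - γ(0)·u∞(0) > 0`, then every streamline of every wave of
`𝓜` has slope `|v/u| < 1`. -/
theorem solitary_slope_lt_one (g Patm : ℝ) (hg : 0 < g)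
    (M : Set (SolitaryWave g Patm))
    (hMW : ∀ W ∈ M, W.MemW)
    (hconn : IsConnected {f : BoundedContinuousFunction ↥(Set.Ici (0:ℝ))
        (ℝ × ℝ × ℝ × ℝ × ℝ × ℝ × ℝ) |
      ∃ W ∈ M, ∀ x : ↥(Set.Ici (0:ℝ)), f x = W.trace x.1})
    (htriv : ∃ W ∈ M, W.IsTrivial)
    (hsurf : ∀ W ∈ M, 0 < g - W.γ 0 * W.uInf 0) :
    ∀ W ∈ M, ∀ p ∈ W.Ωbar, |W.v p| < |W.u p| := by
  exact fun W hW _ hp => W.abs_v_lt_abs_u hg (hMW W hW) (hsurf W hW) hp
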